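/- For every rho > rho_{p} and every t < rho, one has Delta f^rho_{p}(t) <= Delta f^{rho-1}_{p}(t). -/

import Mathlib

open scoped Classical

noncomputable section

/-! ## Binomial expansions and the Macaulay operations `(a_t)^+_+` and `(a_t)^-_-` -/

/-- The largest `k` such that `C(k,t) ≤ a` (top coefficient of the greedy binomial
expansion of `a` in base `t`). -/
def expTop (a t : ℕ) : ℕ := Nat.findGreatest (fun k => Nat.choose k t ≤ a) (a + t + 1)

/-- `(a_t)^+_+` : if `a = C(k(t),t) + ... + C(k(j),j)` is the binomial expansion of `a`
in base `t`, then `plusPlus a t = C(k(t)+1,t+1) + ... + C(k(j)+1,j+1)`; it sends `0` to `0`. -/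
def plusPlus : ℕ → ℕ → ℕ
  | _, 0 => 0
  | a, t + 1 =>
    if a = 0 then 0
    else Nat.choose (expTop a (t + 1) + 1) (t + 2) +
      plusPlus (a - Nat.choose (expTop a (t + 1)) (t + 1)) t

/-- `(a_t)^-_-` : if `a = C(k(t),t) + ... + C(k(j),j)` is the binomial expansion of `a`
in base `t`, then `minusMinus a t = C(k(t)-1,t-1) + ... + C(k(j)-1,j-1)`; it sends `0` to `0`. -/
def minusMinus : ℕ → ℕ → ℕ
  | _, 0 => 0
  | a, t + 1 =>
    if a = 0 then 0
    else Nat.choose (expTop a (t + 1) - 1) t +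
      minusMinus (a - Nat.choose (expTop a (t + 1)) (t + 1)) t

/-! ## Numerical functions -/

/-- A numerical function (modelled with values in `ℤ`) is *admissible* (an O-sequence) if it is
nonnegative, `H 0 = 1` and `H (t+1) ≤ (H(t)_t)^+_+` for every `t ≥ 1`. -/
def OSeq (H : ℕ → ℤ) : Prop :=
  (∀ t, 0 ≤ H t) ∧ H 0 = 1 ∧ ∀ t, 1 ≤ t → H (t + 1) ≤ (plusPlus (H t).toNat t : ℤ)

/-- First derivative of a numerical function: `Δf(0) = 1`, `Δf(t) = f(t) - f(t-1)`. -/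
def nderiv (f : ℕ → ℤ) : ℕ → ℤ
  | 0 => 1
  | t + 1 => f (t + 1) - f t

/-- Integral of a numerical function: `Σg(0) = 1`, `Σg(t) = Σg(t-1) + g(t)`. -/
def ninteg (g : ℕ → ℤ) : ℕ → ℤ
  | 0 => 1
  | t + 1 => ninteg g t + g (t + 1)

/-! ## Admissible Hilbert polynomials in Gotzmann form -/

/-- The integer-valued binomial coefficient `C(a,k)` for `a : ℤ`, agreeing with the
polynomial binomial coefficient `a(a-1)⋯(a-k+1)/k!`. -/
def zchoose (a : ℤ) (k : ℕ) : ℤ :=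
  if 0 ≤ a then (a.toNat.choose k : ℤ)
  else (-1) ^ k * (((k : ℤ) - 1 - a).toNat.choose k : ℤ)

/-- An admissible Hilbert polynomial, recorded through its Gotzmann form
`p(z) = C(z+k₁,k₁) + C(z+k₂-1,k₂) + ... + C(z+k_r-(r-1),k_r)` with `k₁ ≥ k₂ ≥ ... ≥ k_r ≥ 0`. -/
structure GotzmannPoly where
  ks : List ℕ
  sorted : ks.Pairwise (· ≥ ·)

namespace GotzmannPoly

/-- The Gotzmann number `r` of `p`. -/
def r (p : GotzmannPoly) : ℕ := p.ks.length

/-- The degree of `p`, namely `k₁`. -/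
def degree (p : GotzmannPoly) : ℕ := p.ks.headD 0

/-- Evaluation of `p` at an integer. -/
def eval (p : GotzmannPoly) (z : ℤ) : ℤ :=
  ∑ i ∈ Finset.range p.r, zchoose (z + (p.ks.getD i 0 : ℤ) - i) (p.ks.getD i 0)

/-- The first difference `Δp(z) = p(z) - p(z-1)`, in Gotzmann form. -/
def delta (p : GotzmannPoly) : GotzmannPoly where
  ks := (p.ks.filter fun k => 1 ≤ k).map fun k => k - 1
  sorted := by
    refine List.Pairwise.map _ (fun {a b} h => Nat.sub_le_sub_right h 1) ?_
    exact p.sorted.filter _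

/-- Iterated first difference `Δ^i p`. -/
def deltaIter (p : GotzmannPoly) (i : ℕ) : GotzmannPoly := delta^[i] p

/-- The polynomial `p(z) + c`, in Gotzmann form. -/
def addConst (p : GotzmannPoly) (c : ℕ) : GotzmannPoly where
  ks := p.ks ++ List.replicate c 0
  sorted := by
    rw [List.pairwise_append]
    refine ⟨p.sorted, ?_, ?_⟩
    · exact List.pairwise_replicate.2 (Or.inr le_rfl)
    · intro a _ b hb
      rw [List.eq_of_mem_replicate hb]
      exact Nat.zero_le a

end GotzmannPoly

/-- The set `Π_p = {1 ≤ t ≤ r : (p(t+h)_{t+h})^+_+ ≥ p(t+h+1) ≥ 1 for all h ≥ 0}`. -/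
def PiSet (p : GotzmannPoly) : Set ℕ :=
  {t | 1 ≤ t ∧ t ≤ p.r ∧ ∀ h : ℕ,
      p.eval ((t : ℤ) + (h : ℤ) + 1) ≤ (plusPlus (p.eval ((t : ℤ) + (h : ℤ))).toNat (t + h) : ℤ) ∧
      1 ≤ p.eval ((t : ℤ) + (h : ℤ) + 1)}

/-- `ρ_p`: `0` if `min Π_p = 1` and `p(0) = 1`, and `min Π_p` otherwise. -/
def rhoP (p : GotzmannPoly) : ℕ :=
  if sInf (PiSet p) = 1 ∧ p.eval 0 = 1 then 0 else sInf (PiSet p)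

/-- The minimal function `f^ρ_p` : `f(t) = p(t)` for `t ≥ ρ` and
`f(t) = ((f(t+1))_{t+1})^-_-` for `t < ρ`. -/
def fmin (p : GotzmannPoly) (ρ : ℕ) (t : ℕ) : ℤ :=
  if h : ρ ≤ t then p.eval (t : ℤ)
  else (minusMinus (fmin p ρ (t + 1)).toNat (t + 1) : ℤ)
termination_by ρ - t
decreasing_by omega

/-- The function `g^ρ_p` : `g(t) = p(t)` for `t ≥ ρ`, `g(ρ-1) = p(ρ-1) + 1` and
`g(t) = ((g(t+1))_{t+1})^-_-` for `t < ρ-1`. -/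
def gmin (p : GotzmannPoly) (ρ : ℕ) (t : ℕ) : ℤ :=
  if h : ρ ≤ t then p.eval (t : ℤ)
  else if t = ρ - 1 then p.eval (t : ℤ) + 1
  else (minusMinus (gmin p ρ (t + 1)).toNat (t + 1) : ℤ)
termination_by ρ - t
decreasing_by omega

/-- `H` has regularity `ρ` (with respect to the Hilbert polynomial `p`): `ρ` is the least
integer such that `H(t) = p(t)` for all `t ≥ ρ`. -/
def IsRegOf (p : GotzmannPoly) (H : ℕ → ℤ) (ρ : ℕ) : Prop :=
  (∀ t : ℕ, ρ ≤ t → H t = p.eval (t : ℤ)) ∧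
  ∀ ρ' : ℕ, (∀ t : ℕ, ρ' ≤ t → H t = p.eval (t : ℤ)) → ρ ≤ ρ'

/-- `H` has Hilbert polynomial `p`, i.e. eventually agrees with `p`. -/
def HasHP (p : GotzmannPoly) (H : ℕ → ℤ) : Prop :=
  ∃ N : ℕ, ∀ t : ℕ, N ≤ t → H t = p.eval (t : ℤ)

/-- `F(p,ρ)`: the set of Hilbert functions of closed projective subschemes (i.e. numerical
functions which are admissible together with their first derivative) with Hilbert
polynomial `p` and regularity `ρ`. -/
def Fset (p : GotzmannPoly) (ρ : ℕ) : Set (ℕ → ℤ) :=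
  {H | OSeq H ∧ OSeq (nderiv H) ∧ IsRegOf p H ρ}

/-- `ρ̄_p`: the minimal `ρ` such that `F(p,ρ)` is non-empty. -/
def rhobar (p : GotzmannPoly) : ℕ := sInf {ρ | (Fset p ρ).Nonempty}

/-! ## Monomial ideals in `K[x₀,…,xₙ]` (combinatorial model) -/

/-- Monomials of `K[x₀,…,xₙ]`, as exponent vectors. -/
abbrev Mon (n : ℕ) := Fin (n + 1) → ℕ

/-- Degree of a monomial. -/
def mdeg {n : ℕ} (m : Mon n) : ℕ := ∑ i, m i

/-- `T_t`, the set of terms of degree `t`. -/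
def Tset (n t : ℕ) : Set (Mon n) := {m | mdeg m = t}

/-- A set of monomials closed under multiplication by arbitrary monomials (a monomial ideal). -/
def MonIdeal {n : ℕ} (J : Set (Mon n)) : Prop :=
  ∀ m ∈ J, ∀ m' : Mon n, m + m' ∈ J

/-- The elementary Borel move sending `x^m` to `x_i · x^m / x_j`. -/
def borelStep {n : ℕ} (m : Mon n) (j i : Fin (n + 1)) : Mon n :=
  fun l => if l = j then m l - 1 else if l = i then m l + 1 else m l

/-- One elementary Borel move `x_j ↦ x_i` with `j < i`. -/
def borelMove {n : ℕ} (a b : Mon n) : Prop :=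
  ∃ j i : Fin (n + 1), j < i ∧ 1 ≤ a j ∧ b = borelStep a j i

/-- The Borel (partial) order `≤_B` on monomials. -/
def borelLE {n : ℕ} : Mon n → Mon n → Prop := Relation.ReflTransGen borelMove

/-- A strongly stable (Borel) monomial ideal. -/
def StronglyStable {n : ℕ} (J : Set (Mon n)) : Prop :=
  MonIdeal J ∧ ∀ m ∈ J, ∀ j i : Fin (n + 1), j < i → 1 ≤ m j → borelStep m j i ∈ J

/-- A Borel set in `T_t`: a set of degree-`t` monomials closed upwards under `≤_B`. -/
def IsBorelSet {n : ℕ} (t : ℕ) (B : Set (Mon n)) : Prop :=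
  B ⊆ Tset n t ∧ ∀ a ∈ B, ∀ b : Mon n, borelLE a b → b ∈ B

/-- Saturation of a monomial ideal:
`J^sat = {m : for every i there is k with x_i^k · m ∈ J}`. -/
def monSat {n : ℕ} (J : Set (Mon n)) : Set (Mon n) :=
  {m | ∀ i : Fin (n + 1), ∃ k : ℕ, (fun l => if l = i then m l + k else m l) ∈ J}

/-- The monomial ideal generated by a set of monomials. -/
def genIdeal {n : ℕ} (B : Set (Mon n)) : Set (Mon n) :=
  {m | ∃ b ∈ B, ∃ c : Mon n, m = b + c}

/-- The Hilbert function of `S/J` for a monomial ideal `J`: the number of degree-`t`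
monomials outside `J`. -/
def hilb {n : ℕ} (J : Set (Mon n)) (t : ℕ) : ℕ :=
  Set.ncard {m : Mon n | mdeg m = t ∧ m ∉ J}

/-- `m / x_i` as an exponent vector. -/
def shrinkAt {n : ℕ} (m : Mon n) (i : Fin (n + 1)) : Mon n :=
  fun l => if l = i then m l - 1 else m l

/-- `m` is a minimal (monomial) generator of the monomial ideal `J`. -/
def IsMinGen {n : ℕ} (J : Set (Mon n)) (m : Mon n) : Prop :=
  m ∈ J ∧ ∀ i : Fin (n + 1), 1 ≤ m i → shrinkAt m i ∉ J

/-- The Castelnuovo–Mumford regularity of a strongly stable ideal: the maximal degree of a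
minimal monomial generator. -/
def monReg {n : ℕ} (J : Set (Mon n)) : ℕ :=
  sSup {d | ∃ m : Mon n, IsMinGen J m ∧ mdeg m = d}

/-- `m_u`: the minimal Castelnuovo–Mumford regularity of a closed projective subscheme with
Hilbert function `u`, i.e. the minimum of `reg J` over all `n` and all saturated strongly
stable ideals `J ⊆ K[x₀,…,xₙ]` with `H_{S/J} = u`. -/
def mReg (u : ℕ → ℤ) : ℕ :=
  sInf {r | ∃ (n : ℕ) (J : Set (Mon n)), StronglyStable J ∧ monSat J = J ∧
      (∀ t : ℕ, (hilb J t : ℤ) = u t) ∧ monReg J = r}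

/-- `M(p,ρ) = {m_u : u ∈ F(p,ρ)}`. -/
def Mset (p : GotzmannPoly) (ρ : ℕ) : Set ℕ := {r | ∃ u ∈ Fset p ρ, mReg u = r}

/-- `m^ρ_p = min M(p,ρ)`. -/
def mRho (p : GotzmannPoly) (ρ : ℕ) : ℕ := sInf (Mset p ρ)

/-- `m_p`: the minimal Castelnuovo–Mumford regularity of schemes with Hilbert polynomial `p`. -/
def mP (p : GotzmannPoly) : ℕ := sInf {r | ∃ ρ : ℕ, ∃ u ∈ Fset p ρ, mReg u = r}

/-! ## Lex segments and growth-height-lexicographic Borel sets -/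

/-- `a` is smaller than `b` in the deglex order (for monomials of the same degree):
`a k < b k` where `k` is the largest index where they differ. -/
def deglexLT {n : ℕ} (a b : Mon n) : Prop :=
  ∃ k : Fin (n + 1), a k < b k ∧ ∀ l : Fin (n + 1), k < l → a l = b l

/-- A lex-segment of `T_t`: a set of degree-`t` monomials consisting of the highest terms
with respect to deglex. -/
def IsLexSeg {n : ℕ} (t : ℕ) (L : Set (Mon n)) : Prop :=
  L ⊆ Tset n t ∧ ∀ a ∈ L, ∀ b ∈ Tset n t, deglexLT a b → b ∈ L

/-- A lex-segment in `A ⊆ T_t`: the intersection of a lex-segment of `T_t` with `A`. -/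
def LexSegIn {n : ℕ} (t : ℕ) (A S : Set (Mon n)) : Prop :=
  ∃ L : Set (Mon n), IsLexSeg t L ∧ S = L ∩ A

/-- The growth class `B^{(i)} = {m ∈ B : min(m) = i}`. -/
def growthClass {n : ℕ} (B : Set (Mon n)) (i : Fin (n + 1)) : Set (Mon n) :=
  {m | m ∈ B ∧ 1 ≤ m i ∧ ∀ j : Fin (n + 1), j < i → m j = 0}

/-- The height class `B(i) = {m ∈ B : the exponent of x₀ in m is i}`. -/
def heightClass {n : ℕ} (B : Set (Mon n)) (i : ℕ) : Set (Mon n) :=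
  {m | m ∈ B ∧ m 0 = i}

/-- A Borel set `B ⊆ T_t` is growth-lexicographic if all its growth classes are lex-segments
in the corresponding growth classes of `T_t`. -/
def GrowthLex {n : ℕ} (t : ℕ) (B : Set (Mon n)) : Prop :=
  ∀ i : Fin (n + 1), LexSegIn t (growthClass (Tset n t) i) (growthClass B i)

/-- A Borel set `B ⊆ T_t` is growth-height-lexicographic if `B(0)` is growth-lexicographic
and `B(i)` is a lex-segment in `T_t(i)` for every `0 < i ≤ t`. -/
def GHLex {n : ℕ} (t : ℕ) (B : Set (Mon n)) : Prop :=
  GrowthLex t (heightClass B 0) ∧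
  ∀ i : ℕ, 0 < i → i ≤ t → LexSegIn t (heightClass (Tset n t) i) (heightClass B i)

end

section MacaulayOperations

theorem lt_choose_add_succ (a t : ℕ) : a < (a + t + 1).choose (t + 1) := by
  induction a with
  | zero => simp
  | succ a ih =>
    have h : 0 < (a + t + 1).choose t := Nat.choose_pos (by omega)
    have h' := Nat.choose_succ_succ (a + t + 1) t
    rw [show a + 1 + t + 1 = a + t + 1 + 1 by ring]
    simp only [Nat.succ_eq_add_one] at h'
    omega

theorem expTop_eq {a t k : ℕ} (h₁ : k.choose (t + 1) ≤ a) (h₂ : a < (k + 1).choose (t + 1)) :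
    expTop a (t + 1) = k := by
  unfold expTop
  rw [Nat.findGreatest_eq_iff]
  refine ⟨?_, fun _ => h₁, fun n hn _ hna => ?_⟩
  · by_contra! hk
    have := Nat.choose_le_choose (t + 1) (show a + t + 1 ≤ k by omega)
    have := lt_choose_add_succ a t
    omega
  · have := Nat.choose_le_choose (t + 1) (show k + 1 ≤ n by omega)
    omega

theorem choose_expTop_le (a t : ℕ) : (expTop a (t + 1)).choose (t + 1) ≤ a :=
  Nat.findGreatest_spec (P := fun k => k.choose (t + 1) ≤ a) (Nat.zero_le _) (by simp)

theorem lt_choose_expTop_succ (a t : ℕ) : a < (expTop a (t + 1) + 1).choose (t + 1) := by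
  by_contra! h
  have hle : expTop a (t + 1) + 1 ≤ a + (t + 1) + 1 := by
    by_contra! hk
    have := Nat.choose_le_choose (t + 1)
      (show a + t + 1 ≤ expTop a (t + 1) + 1 by omega)
    have := lt_choose_add_succ a t
    omega
  have := Nat.le_findGreatest (P := fun k => k.choose (t + 1) ≤ a) hle h
  have h' : expTop a (t + 1) + 1 ≤ expTop a (t + 1) := this
  omega

theorem lt_expTop {a t : ℕ} (ha : a ≠ 0) : t < expTop a (t + 1) := by
  have h := lt_choose_expTop_succ a t
  by_contra! hk
  have := Nat.choose_le_choose (t + 1) (show expTop a (t + 1) + 1 ≤ t + 1 by omega)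
  simp at this
  omega

theorem expTop_lt_of_lt_choose {a t n : ℕ} (h : a < n.choose (t + 1)) :
    expTop a (t + 1) < n := by
  by_contra! hn
  have := Nat.choose_le_choose (t + 1) hn
  have := choose_expTop_le a t
  omega

theorem expTop_mono {a b t : ℕ} (h : a ≤ b) : expTop a (t + 1) ≤ expTop b (t + 1) :=
  Nat.le_of_lt_succ (expTop_lt_of_lt_choose (h.trans_lt (lt_choose_expTop_succ b t)))

theorem sub_choose_expTop_lt (a t : ℕ) :
    a - (expTop a (t + 1)).choose (t + 1) < (expTop a (t + 1)).choose t := by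
  have h := lt_choose_expTop_succ a t
  have h' := choose_expTop_le a t
  rw [Nat.choose_succ_succ'] at h
  omega

/-- The sum of `c (k i) i` over the binomial expansion `a = C(k(t),t) + ... + C(k(j),j)`. -/
noncomputable def expansionSum (c : ℕ → ℕ → ℕ) : ℕ → ℕ → ℕ
  | _, 0 => 0
  | a, t + 1 =>
    if a = 0 then 0
    else c (expTop a (t + 1)) (t + 1) +
      expansionSum c (a - (expTop a (t + 1)).choose (t + 1)) t

@[simp] theorem expansionSum_zero (c : ℕ → ℕ → ℕ) (t : ℕ) : expansionSum c 0 t = 0 := by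
  cases t <;> simp [expansionSum]

theorem expansionSum_le {c : ℕ → ℕ → ℕ} (hc : ∀ t, Monotone fun k => c k t)
    (hp : ∀ k t, 1 ≤ k → c k (t + 1) + c k t ≤ c (k + 1) (t + 1))
    {a t n : ℕ} (h : a < n.choose t) : expansionSum c a t ≤ c n t := by
  induction t generalizing a n with
  | zero => simp [expansionSum]
  | succ t ih =>
    rw [expansionSum]
    split_ifs with ha
    · exact Nat.zero_le _
    · have h₁ := ih (sub_choose_expTop_lt a t)
      have h₂ := hp (expTop a (t + 1)) t (by have := lt_expTop (t := t) ha; omega)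
      have h₃ : c (expTop a (t + 1) + 1) (t + 1) ≤ c n (t + 1) :=
        hc (t + 1) (expTop_lt_of_lt_choose h)
      omega

theorem expansionSum_mono {c : ℕ → ℕ → ℕ} (hc : ∀ t, Monotone fun k => c k t)
    (hp : ∀ k t, 1 ≤ k → c k (t + 1) + c k t ≤ c (k + 1) (t + 1)) (t : ℕ) :
    Monotone fun a => expansionSum c a t := by
  induction t with
  | zero => intro a b _; simp [expansionSum]
  | succ t ih =>
    intro a b hab
    simp only
    by_cases ha : a = 0
    · simp [ha]
    have hb : b ≠ 0 := by omega
    rcases (expTop_mono (t := t) hab).eq_or_lt with hk | hk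
    · rw [expansionSum, expansionSum, if_neg ha, if_neg hb, hk]
      have := ih (Nat.sub_le_sub_right hab ((expTop b (t + 1)).choose (t + 1)))
      simp only at this
      omega
    · have h₁ := expansionSum_le hc hp (lt_choose_expTop_succ a t)
      have h₂ : c (expTop a (t + 1) + 1) (t + 1) ≤ c (expTop b (t + 1)) (t + 1) :=
        hc (t + 1) hk
      rw [expansionSum.eq_2 c b, if_neg hb]
      omega

theorem minusMinus_eq_expansionSum (a t : ℕ) :
    minusMinus a t =
      expansionSum (fun k i => if i = 0 then 0 else (k - 1).choose (i - 1)) a t := by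
  induction t generalizing a with
  | zero => rfl
  | succ t ih => simp [minusMinus, expansionSum, ih]

theorem minusMinus_mono (t : ℕ) : Monotone fun a => minusMinus a t := by
  simp only [minusMinus_eq_expansionSum]
  refine expansionSum_mono (fun t a b hab => ?_) (fun k t hk => ?_) t
  · simp only
    split_ifs
    · rfl
    · exact Nat.choose_le_choose _ (by omega)
  · obtain ⟨k, rfl⟩ := Nat.exists_eq_add_of_le' hk
    rcases t with _ | t
    · simp
    · simp [Nat.choose_succ_succ', add_comm]

theorem minusMinus_add_expansionSum {a t : ℕ} (h : t = 0 → a = 0) :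
    minusMinus a t + expansionSum (fun k i => (k - 1).choose i) a t = a := by
  induction t generalizing a with
  | zero => simp [minusMinus, expansionSum, h rfl]
  | succ t ih =>
    rw [minusMinus, expansionSum]
    split_ifs with ha
    · omega
    have hle := choose_expTop_le a t
    have hlt := sub_choose_expTop_lt a t
    have := ih (a := a - (expTop a (t + 1)).choose (t + 1)) (by rintro rfl; simpa using hlt)
    obtain ⟨k, hk⟩ := Nat.exists_eq_add_of_lt (lt_expTop (t := t) ha)
    have hc := Nat.choose_succ_succ' (t + k) t
    have hp : expTop a (t + 1) - 1 = t + k := by omega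
    rw [← hk] at hc
    rw [hp]
    omega

theorem sub_minusMinus_mono (t : ℕ) {a b : ℕ} (hab : a ≤ b) :
    (a : ℤ) - minusMinus a (t + 1) ≤ b - minusMinus b (t + 1) := by
  have hm : expansionSum (fun k i => (k - 1).choose i) a (t + 1) ≤
      expansionSum (fun k i => (k - 1).choose i) b (t + 1) := by
    refine expansionSum_mono (fun t a b hab => ?_) (fun k t hk => ?_) (t + 1) hab
    · exact Nat.choose_le_choose _ (by omega)
    · obtain ⟨k, rfl⟩ := Nat.exists_eq_add_of_le' hk
      simp [Nat.choose_succ_succ', add_comm]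
  have ha := minusMinus_add_expansionSum (a := a) (t := t + 1) (by simp)
  have hb := minusMinus_add_expansionSum (a := b) (t := t + 1) (by simp)
  omega

@[simp] theorem plusPlus_zero (t : ℕ) : plusPlus 0 t = 0 := by
  cases t <;> simp [plusPlus]

@[simp] theorem minusMinus_zero (t : ℕ) : minusMinus 0 t = 0 := by
  cases t <;> simp [minusMinus]

theorem plusPlus_lt {a t n : ℕ} (h : a < n.choose t) :
    plusPlus a t < (n + 1).choose (t + 1) := by
  induction t generalizing a n with
  | zero => simp [plusPlus]
  | succ t ih =>
    rw [plusPlus]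
    split_ifs with ha
    · refine Nat.choose_pos ?_
      by_contra! hn
      rw [Nat.choose_eq_zero_of_lt (by omega)] at h
      omega
    · have h₁ := ih (sub_choose_expTop_lt a t)
      have h₂ : (expTop a (t + 1) + 1 + 1).choose (t + 2) =
          (expTop a (t + 1) + 1).choose (t + 1) + (expTop a (t + 1) + 1).choose (t + 2) :=
        Nat.choose_succ_succ' _ _
      have h₃ : (expTop a (t + 1) + 1 + 1).choose (t + 2) ≤ (n + 1).choose (t + 2) :=
        Nat.choose_le_choose (t + 2) (Nat.succ_le_succ (expTop_lt_of_lt_choose h))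
      rw [show t + 1 + 1 = t + 2 from rfl]
      omega

theorem minusMinus_plusPlus {a t : ℕ} (h : t = 0 → a = 0) :
    minusMinus (plusPlus a t) (t + 1) = a := by
  induction t generalizing a with
  | zero => simp [plusPlus, h rfl]
  | succ t ih =>
    by_cases ha : a = 0
    · simp [ha]
    have hlt := sub_choose_expTop_lt a t
    have hle := choose_expTop_le a t
    have hr := plusPlus_lt hlt
    have htop : expTop (plusPlus a (t + 1)) (t + 1 + 1) = expTop a (t + 1) + 1 := by
      refine expTop_eq ?_ (plusPlus_lt (lt_choose_expTop_succ a t))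
      rw [plusPlus, if_neg ha]
      exact Nat.le_add_right _ _
    have hne : plusPlus a (t + 1) ≠ 0 := by
      have : 0 < (expTop a (t + 1) + 1).choose (t + 2) :=
        Nat.choose_pos (Nat.succ_le_succ (lt_expTop (t := t) ha))
      rw [plusPlus, if_neg ha]
      omega
    have hih := ih (a := a - (expTop a (t + 1)).choose (t + 1)) (by rintro rfl; simpa using hlt)
    rw [minusMinus, if_neg hne, htop, plusPlus, if_neg ha, Nat.add_sub_cancel_left, hih,
      Nat.add_sub_cancel]
    omega

end MacaulayOperations

section GotzmannForm

/-- The binomial expansion `C(t+k₁,t) + C(t-1+k₂,t-1) + ...` attached to a list of exponents. -/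
def gotzmannSum : List ℕ → ℕ → ℕ
  | [], _ => 0
  | k :: ks, t => (t + k).choose t + gotzmannSum ks (t - 1)

theorem gotzmannSum_lt {ks : List ℕ} {t K : ℕ} (hs : ks.Pairwise (· ≥ ·)) (hK : ∀ k ∈ ks, k ≤ K)
    (ht : ks.length ≤ t) : gotzmannSum ks t < (t + K + 1).choose t := by
  induction ks generalizing t K with
  | nil => exact Nat.choose_pos (by omega)
  | cons k ks ih =>
    rw [List.pairwise_cons] at hs
    obtain ⟨t, rfl⟩ : ∃ s, t = s + 1 := ⟨t - 1, by simp at ht; omega⟩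
    have h := ih (t := t) hs.2 hs.1 (by simpa using ht)
    have h₁ := Nat.choose_succ_succ' (t + k + 1) t
    have h₂ := Nat.choose_le_choose (t + 1)
      (show t + k + 1 + 1 ≤ t + 1 + K + 1 by have := hK k (by simp); omega)
    rw [gotzmannSum, Nat.add_sub_cancel, show t + 1 + k = t + k + 1 by ring]
    omega

theorem plusPlus_gotzmannSum {ks : List ℕ} {t : ℕ} (hs : ks.Pairwise (· ≥ ·))
    (ht : ks.length ≤ t) : plusPlus (gotzmannSum ks t) t = gotzmannSum ks (t + 1) := by
  induction ks generalizing t with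
  | nil => simp [gotzmannSum]
  | cons k ks ih =>
    obtain ⟨t, rfl⟩ : ∃ s, t = s + 1 := ⟨t - 1, by simp at ht; omega⟩
    have hlt := gotzmannSum_lt (K := k) hs
      (by rw [List.pairwise_cons] at hs; simpa using hs.1) ht
    rw [List.pairwise_cons] at hs
    have h := ih (t := t) hs.2 (by simpa using ht)
    have hpos : 0 < (t + 1 + k).choose (t + 1) := Nat.choose_pos (by omega)
    have htop : expTop (gotzmannSum (k :: ks) (t + 1)) (t + 1) = t + 1 + k :=
      expTop_eq (by rw [gotzmannSum]; exact Nat.le_add_right _ _) hlt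
    rw [plusPlus, if_neg (by rw [gotzmannSum]; omega), htop, gotzmannSum, gotzmannSum,
      Nat.add_sub_cancel_left, Nat.add_sub_cancel, Nat.add_sub_cancel, h,
      show t + 1 + 1 + k = t + 1 + k + 1 by ring]

theorem sum_zchoose_eq_gotzmannSum (ks : List ℕ) (t : ℕ) (ht : ks.length ≤ t) :
    ∑ i ∈ Finset.range ks.length, zchoose ((t : ℤ) + (ks.getD i 0 : ℤ) - i) (ks.getD i 0) =
      gotzmannSum ks t := by
  induction ks generalizing t with
  | nil => simp [gotzmannSum]
  | cons k ks ih =>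
    obtain ⟨t, rfl⟩ : ∃ s, t = s + 1 := ⟨t - 1, by simp at ht; omega⟩
    rw [List.length_cons, Finset.sum_range_succ', gotzmannSum, Nat.add_sub_cancel,
      Nat.cast_add (Nat.choose _ _), ← ih t (by simpa using ht), add_comm]
    congr 1
    · have h : ((t + 1 : ℕ) : ℤ) + (k : ℤ) - (0 : ℕ) = ((t + 1 + k : ℕ) : ℤ) := by
        push_cast; ring
      simp only [List.getD_cons_zero]
      rw [zchoose, h, if_pos (by positivity), Int.toNat_natCast, Nat.choose_symm_add]
    · refine Finset.sum_congr rfl fun i _ => ?_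
      rw [List.getD_cons_succ]
      congr 1
      push_cast
      ring

theorem GotzmannPoly.eval_eq_gotzmannSum (p : GotzmannPoly) {t : ℕ} (ht : p.r ≤ t) :
    p.eval (t : ℤ) = gotzmannSum p.ks t :=
  sum_zchoose_eq_gotzmannSum p.ks t ht

theorem GotzmannPoly.r_mem_PiSet (p : GotzmannPoly) (hr : 1 ≤ p.r) : p.r ∈ PiSet p := by
  refine ⟨hr, le_rfl, fun h => ?_⟩
  have h₁ := p.eval_eq_gotzmannSum (show p.r ≤ p.r + h by omega)
  have h₂ := p.eval_eq_gotzmannSum (show p.r ≤ p.r + h + 1 by omega)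
  push_cast at h₁ h₂
  rw [h₁, h₂, Int.toNat_natCast, plusPlus_gotzmannSum p.sorted (show p.r ≤ p.r + h by omega)]
  refine ⟨le_rfl, ?_⟩
  obtain ⟨k, ks, hks⟩ := List.exists_cons_of_length_pos (l := p.ks) hr
  have : 0 < (p.r + h + 1 + k).choose (p.r + h + 1) := Nat.choose_pos (by omega)
  rw [hks, gotzmannSum]
  push_cast
  omega

end GotzmannForm

theorem eval_growth_of_rhoP_le {p : GotzmannPoly} (hr : 1 ≤ p.r) {s : ℕ} (hs : rhoP p ≤ s)
    (hs₁ : 1 ≤ s) :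
    p.eval ((s : ℤ) + 1) ≤ (plusPlus (p.eval (s : ℤ)).toNat s : ℤ) ∧
      1 ≤ p.eval ((s : ℤ) + 1) := by
  have hmem := Nat.sInf_mem ⟨_, p.r_mem_PiSet hr⟩
  have hle : sInf (PiSet p) ≤ s := by
    unfold rhoP at hs
    split_ifs at hs with h
    · omega
    · exact hs
  obtain ⟨h, rfl⟩ := Nat.exists_eq_add_of_le hle
  simpa using hmem.2.2 h

theorem fmin_of_le {p : GotzmannPoly} {ρ t : ℕ} (h : ρ ≤ t) : fmin p ρ t = p.eval (t : ℤ) := by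
  rw [fmin, dif_pos h]

theorem fmin_of_lt {p : GotzmannPoly} {ρ t : ℕ} (h : t < ρ) :
    fmin p ρ t = minusMinus (fmin p ρ (t + 1)).toNat (t + 1) := by
  rw [fmin, dif_neg (by omega)]

theorem fmin_succ_le_fmin {p : GotzmannPoly} (hr : 1 ≤ p.r) {s : ℕ} (hs : rhoP p ≤ s)
    (hs₁ : 1 ≤ s) {t : ℕ} (ht : t ≤ s) :
    0 ≤ fmin p (s + 1) t ∧ fmin p (s + 1) t ≤ fmin p s t := by
  induction ht using Nat.decreasingInduction with
  | self =>
    obtain ⟨h₁, h₂⟩ := eval_growth_of_rhoP_le hr hs hs₁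
    rw [fmin_of_lt (Nat.lt_succ_self s), fmin_of_le le_rfl, fmin_of_le le_rfl]
    push_cast
    refine ⟨by positivity, ?_⟩
    have hm := minusMinus_mono (s + 1)
      (show (p.eval ((s : ℤ) + 1)).toNat ≤ plusPlus (p.eval (s : ℤ)).toNat s by omega)
    simp only at hm
    rw [minusMinus_plusPlus (by omega)] at hm
    rcases le_or_gt (p.eval (s : ℤ)) 0 with h | h
    · rw [Int.toNat_of_nonpos h, plusPlus_zero] at h₁
      push_cast at h₁
      omega
    · omega
  | of_succ t ht ih =>
    rw [fmin_of_lt (Nat.lt_succ_of_lt ht), fmin_of_lt ht]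
    refine ⟨by positivity, ?_⟩
    exact_mod_cast minusMinus_mono (t + 1) (Int.toNat_le_toNat ih.2)

/-- Lemma `lemma:first derivative` (ii).
For every `ρ > ρ_p` and every `t < ρ`, one has `Δf^ρ_p(t) ≤ Δf^{ρ-1}_p(t)`. -/
theorem statement5 (p : GotzmannPoly) (hr : 1 < p.r) (ρ : ℕ) (hρ : rhoP p < ρ)
    (t : ℕ) (ht : t < ρ) :
    nderiv (fmin p ρ) t ≤ nderiv (fmin p (ρ - 1)) t := by
  obtain ⟨s, rfl⟩ : ∃ s, ρ = s + 1 := ⟨ρ - 1, by omega⟩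
  rw [Nat.add_sub_cancel]
  rcases t with _ | t
  · exact le_rfl
  · obtain ⟨h₀, hle⟩ := fmin_succ_le_fmin (p := p) (t := t + 1) hr.le (Nat.le_of_lt_succ hρ)
      (by omega) (by omega)
    simp only [nderiv]
    rw [fmin_of_lt (show t < s + 1 by omega), fmin_of_lt (show t < s by omega)]
    have h := sub_minusMinus_mono t (Int.toNat_le_toNat hle)
    rwa [Int.toNat_of_nonneg h₀, Int.toNat_of_nonneg (h₀.trans hle)] at h
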